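/- Monotonicity of the Chernoff rate function h: The function h is non-increasing on (−1, ∞); that is, for all reals x, y with −1 < x ≤ y, one has h(y) ≤ h(x). -/

import Mathlib

open Real

/-- The Chernoff rate function `h(x) = 2((1+x)log(1+x) − x)/x²` for `x ≠ 0`, `h(0) = 1`. -/
noncomputable def chernoffRate (x : ℝ) : ℝ :=
  if x = 0 then 1 else 2 * ((1 + x) * Real.log (1 + x) - x) / x ^ 2

lemma chernoff_pos {x s : ℝ} (hx : -1 < x) (h0 : 0 ≤ s) (h1 : s ≤ 1) : 0 < 1 + s * x := by
  rcases le_total 0 x with h | h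
  · positivity
  · nlinarith

lemma chernoff_int {x : ℝ} (hx : -1 < x) :
    IntervalIntegrable (fun s : ℝ => 2 * (1 - s) / (1 + s * x)) MeasureTheory.volume 0 1 := by
  apply ContinuousOn.intervalIntegrable
  rw [Set.uIcc_of_le zero_le_one]
  apply ContinuousOn.div (by fun_prop) (by fun_prop)
  intro s hs
  exact (chernoff_pos hx hs.1 hs.2).ne'

lemma chernoff_eq {x : ℝ} (hx : -1 < x) :
    chernoffRate x = ∫ s in (0:ℝ)..1, 2 * (1 - s) / (1 + s * x) := by
  by_cases h : x = 0
  · subst h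
    have key := intervalIntegral.integral_eq_sub_of_hasDerivAt
      (f := fun s : ℝ => 2 * s - s ^ 2) (a := 0) (b := 1)
      (f' := fun s : ℝ => 2 * (1 - s) / (1 + s * 0)) (fun s _ => by
        have := ((hasDerivAt_id s).const_mul 2).sub ((hasDerivAt_id s).pow 2)
        refine this.congr_deriv ?_
        simp
        ring) (chernoff_int hx)
    rw [key]
    norm_num [chernoffRate]
  · have key := intervalIntegral.integral_eq_sub_of_hasDerivAt
      (f := fun s : ℝ => 2 * ((1 + x) / x ^ 2 * Real.log (1 + s * x) - s / x)) (a := 0) (b := 1)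
      (f' := fun s : ℝ => 2 * (1 - s) / (1 + s * x)) (fun s hs => by
        rw [Set.uIcc_of_le zero_le_one] at hs
        have hp := (chernoff_pos hx hs.1 hs.2).ne'
        have h1 : HasDerivAt (fun s : ℝ => 1 + s * x) x s := by
          simpa using ((hasDerivAt_id s).mul_const x).const_add 1
        have := (((h1.log hp).const_mul ((1 + x) / x ^ 2)).sub
          ((hasDerivAt_id s).div_const x)).const_mul 2
        refine this.congr_deriv ?_
        have hp2 : 1 + x * s ≠ 0 := by rwa [mul_comm x s]
        rw [mul_comm s x]
        field_simp
        ring) (chernoff_int hx)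
    rw [key]
    simp only [chernoffRate, if_neg h]
    simp
    field_simp

/-- Monotonicity of the Chernoff rate function `h`: `h` is non-increasing on `(−1, ∞)`,
that is, for all reals `−1 < x ≤ y`, one has `h(y) ≤ h(x)`. -/
theorem chernoffRate_antitone (x y : ℝ) (hx : -1 < x) (hxy : x ≤ y) :
    chernoffRate y ≤ chernoffRate x := by
  have hy : -1 < y := lt_of_lt_of_le hx hxy
  rw [chernoff_eq hx, chernoff_eq hy]
  apply intervalIntegral.integral_mono_on zero_le_one (chernoff_int hy) (chernoff_int hx)
  intro s hs
  apply div_le_div_of_nonneg_left (by linarith [hs.2]) (chernoff_pos hx hs.1 hs.2)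
  have := mul_le_mul_of_nonneg_left hxy hs.1
  linarith
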